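/- Let (J₁, J₂) be a linear generalized Kähler structure on 𝕍 = V × V* with G = −J₁∘J₂, and let K ⊆ V* be an m-dimensional subspace satisfying, for j = 1, 2: (1) K + J_j(K) ⊆ Ann(K + J_j(K)); (2) J_j(K) ∩ V* = {0}; and (3) a(J₁(K)) ∩ a(J₂(K)) = {0}. Then dim J₁(K) = dim J₂(K) = m, J₁(K) ∩ J₂(K) = {0}, both J₁(K) and J₂(K) are isotropic for ⟨,⟩, ⟨J₁(k), J₂(k')⟩ = ⟨G(k), k'⟩ for all k, k' ∈ K, and the restriction of ⟨,⟩ to J₁(K) ⊕ J₂(K) is nondegenerate; hence this restriction has signature (m, m). (The induced pairing P_K on J₁(K) ⊕ J₂(K) of Section 6.) -/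

import Mathlib

/-- The generalized tangent space `𝕍 = V × V*`. -/
abbrev GV (V : Type*) [AddCommGroup V] [Module ℝ V] := V × Module.Dual ℝ V

variable (V : Type*) [AddCommGroup V] [Module ℝ V] [FiniteDimensional ℝ V]

/-- The canonical symmetric pairing `⟨(X,ξ),(Y,η)⟩ = (1/2)(η X + ξ Y)` on `𝕍`. -/
noncomputable def pairForm : LinearMap.BilinForm ℝ (GV V) :=
  LinearMap.mk₂ ℝ (fun u v => (1 / 2 : ℝ) * (v.2 u.1 + u.2 v.1))
    (fun u u' v => by simp; ring)
    (fun c u v => by simp; ring)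
    (fun u v v' => by simp; ring)
    (fun c u v => by simp; ring)

/-- `V* = {0} × V*` as a subspace of `𝕍`. -/
def VStar : Submodule ℝ (GV V) := LinearMap.range (LinearMap.inr ℝ V (Module.Dual ℝ V))

variable {V}

/-- The annihilator of a subspace of `𝕍` with respect to the canonical pairing. -/
noncomputable def Ann (S : Submodule ℝ (GV V)) : Submodule ℝ (GV V) where
  carrier := {u : GV V | ∀ s ∈ S, pairForm V u s = 0}
  add_mem' := fun ha hb s hs => by simp [ha s hs, hb s hs]
  zero_mem' := fun s hs => by simp
  smul_mem' := fun c a ha s hs => by simp [ha s hs]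

/-- The image in `𝕍` of a subspace `K ⊆ V*`. -/
def ofDual (K : Submodule ℝ (Module.Dual ℝ V)) : Submodule ℝ (GV V) :=
  K.map (LinearMap.inr ℝ V (Module.Dual ℝ V))

/-- A linear generalized complex structure on `𝕍`. -/
structure IsGenCx (J : GV V →ₗ[ℝ] GV V) : Prop where
  sq : ∀ u, J (J u) = -u
  orth : ∀ u v, pairForm V (J u) (J v) = pairForm V u v

/-- A linear generalized Kähler structure on `𝕍`: two commuting linear generalized
complex structures such that `G = -J₁∘J₂` gives a positive definite form `⟨G·,·⟩`. -/
structure IsGenKahler (J₁ J₂ : GV V →ₗ[ℝ] GV V) : Prop where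
  cx1 : IsGenCx J₁
  cx2 : IsGenCx J₂
  comm : ∀ u, J₁ (J₂ u) = J₂ (J₁ u)
  posdef : ∀ u : GV V, u ≠ 0 → 0 < pairForm V (-(J₁ (J₂ u))) u

theorem pairForm_comm {V : Type*} [AddCommGroup V] [Module ℝ V]
    (u v : GV V) : pairForm V u v = pairForm V v u := by
  simp [pairForm, add_comm]

theorem pairForm_dual {V : Type*} [AddCommGroup V] [Module ℝ V]
    (ξ η : Module.Dual ℝ V) : pairForm V ((0 : V), ξ) ((0 : V), η) = 0 := by
  simp [pairForm]

theorem IsGenKahler.pairForm_map_map {V : Type*} [AddCommGroup V] [Module ℝ V]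
    {J₁ J₂ : GV V →ₗ[ℝ] GV V} (h : IsGenKahler J₁ J₂) (u v : GV V) :
    pairForm V (J₁ u) (J₂ v) = pairForm V (-(J₁ (J₂ u))) v := by
  rw [← h.cx2.orth, h.cx2.sq, ← h.comm, map_neg, map_neg, LinearMap.neg_apply]

theorem map_ofDual_eq_range {V : Type*} [AddCommGroup V] [Module ℝ V]
    (J : GV V →ₗ[ℝ] GV V) (K : Submodule ℝ (Module.Dual ℝ V)) :
    (ofDual K).map J =
      LinearMap.range (J ∘ₗ LinearMap.inr ℝ V (Module.Dual ℝ V) ∘ₗ K.subtype) := by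
  rw [LinearMap.range_comp, LinearMap.range_comp, Submodule.range_subtype, ofDual]

section DualIsotropicPair

variable {V : Type*} [AddCommGroup V] [Module ℝ V] {K : Submodule ℝ (Module.Dual ℝ V)}
  {f g : K →ₗ[ℝ] GV V}

theorem injective_left_of_pos (hpos : ∀ w, w ≠ 0 → 0 < pairForm V (f w) (g w)) :
    Function.Injective f := by
  refine (injective_iff_map_eq_zero _).2 fun w hw => ?_
  by_contra hne
  simpa [hw] using hpos w hne

theorem injective_right_of_pos (hpos : ∀ w, w ≠ 0 → 0 < pairForm V (f w) (g w)) :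
    Function.Injective g := by
  refine (injective_iff_map_eq_zero _).2 fun w hw => ?_
  by_contra hne
  simpa [hw] using hpos w hne

theorem range_inf_range_eq_bot_of_pos (hg : ∀ w w', pairForm V (g w) (g w') = 0)
    (hpos : ∀ w, w ≠ 0 → 0 < pairForm V (f w) (g w)) :
    LinearMap.range f ⊓ LinearMap.range g = ⊥ := by
  rw [eq_bot_iff]
  rintro _ ⟨⟨w, rfl⟩, ⟨w', hw'⟩⟩
  by_cases hw : w = 0
  · simp [hw]
  · have := hpos w hw
    rw [← hw', hg] at this
    exact absurd this (lt_irrefl 0)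

theorem eq_zero_of_forall_mem_range_sup (hf : ∀ w w', pairForm V (f w) (f w') = 0) (hg : ∀ w w', pairForm V (g w) (g w') = 0)
    (hpos : ∀ w, w ≠ 0 → 0 < pairForm V (f w) (g w)) (x : GV V)
    (hx : x ∈ LinearMap.range f ⊔ LinearMap.range g)
    (hxy : ∀ y ∈ LinearMap.range f ⊔ LinearMap.range g, pairForm V x y = 0) : x = 0 := by
  obtain ⟨_, ⟨a, rfl⟩, _, ⟨b, rfl⟩, rfl⟩ := Submodule.mem_sup.1 hx
  have ha : a = 0 := by
    by_contra hne
    have h := hxy (g a) (Submodule.mem_sup_right ⟨a, rfl⟩)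
    rw [map_add, LinearMap.add_apply, hg, add_zero] at h
    exact (hpos a hne).ne' h
  have hb : b = 0 := by
    by_contra hne
    have h := hxy (f b) (Submodule.mem_sup_left ⟨b, rfl⟩)
    rw [map_add, LinearMap.add_apply, hf, zero_add, pairForm_comm] at h
    exact (hpos b hne).ne' h
  simp [ha, hb]

/-- The span of two dually paired isotropic subspaces has split signature. -/
theorem exists_pos_neg_splitting (hf : ∀ w w', pairForm V (f w) (f w') = 0) (hg : ∀ w w', pairForm V (g w) (g w') = 0)
    (hpos : ∀ w, w ≠ 0 → 0 < pairForm V (f w) (g w)) :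
    ∃ P Neg : Submodule ℝ (GV V), P ≤ LinearMap.range f ⊔ LinearMap.range g ∧
      Neg ≤ LinearMap.range f ⊔ LinearMap.range g ∧
      P ⊔ Neg = LinearMap.range f ⊔ LinearMap.range g ∧ P ⊓ Neg = ⊥ ∧
      Module.finrank ℝ P = Module.finrank ℝ K ∧ Module.finrank ℝ Neg = Module.finrank ℝ K ∧
      (∀ x ∈ P, x ≠ 0 → 0 < pairForm V x x) ∧ (∀ x ∈ Neg, x ≠ 0 → pairForm V x x < 0) := by
  have hadd : ∀ w, pairForm V ((f + g) w) ((f + g) w) = 2 * pairForm V (f w) (g w) := fun w => by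
    simp only [LinearMap.add_apply, map_add, hf, hg, pairForm_comm (g w) (f w)]
    ring
  have hsub : ∀ w, pairForm V ((f - g) w) ((f - g) w) = -(2 * pairForm V (f w) (g w)) := fun w => by
    simp only [LinearMap.sub_apply, map_sub, hf, hg, pairForm_comm (g w) (f w)]
    ring
  have hP : ∀ x ∈ LinearMap.range (f + g), x ≠ 0 → 0 < pairForm V x x := by
    rintro _ ⟨w, rfl⟩ hx
    have := hpos w fun h => hx (by simp [h])
    rw [hadd]
    linarith
  have hN : ∀ x ∈ LinearMap.range (f - g), x ≠ 0 → pairForm V x x < 0 := by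
    rintro _ ⟨w, rfl⟩ hx
    have := hpos w fun h => hx (by simp [h])
    rw [hsub]
    linarith
  have hleP : LinearMap.range (f + g) ≤ LinearMap.range f ⊔ LinearMap.range g := by
    rintro _ ⟨w, rfl⟩
    exact Submodule.add_mem_sup ⟨w, rfl⟩ ⟨w, rfl⟩
  have hleN : LinearMap.range (f - g) ≤ LinearMap.range f ⊔ LinearMap.range g := by
    rintro _ ⟨w, rfl⟩
    exact Submodule.sub_mem _ (Submodule.mem_sup_left ⟨w, rfl⟩) (Submodule.mem_sup_right ⟨w, rfl⟩)
  refine ⟨LinearMap.range (f + g), LinearMap.range (f - g), hleP, hleN,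
    le_antisymm (sup_le hleP hleN) (sup_le ?_ ?_), ?_, ?_, ?_, hP, hN⟩
  · rintro _ ⟨w, rfl⟩
    refine Submodule.mem_sup.2 ⟨_, ⟨(2⁻¹ : ℝ) • w, rfl⟩, _, ⟨(2⁻¹ : ℝ) • w, rfl⟩, ?_⟩
    simp only [LinearMap.add_apply, LinearMap.sub_apply, map_smul]
    module
  · rintro _ ⟨w, rfl⟩
    refine Submodule.mem_sup.2 ⟨_, ⟨(2⁻¹ : ℝ) • w, rfl⟩, _, ⟨-(2⁻¹ : ℝ) • w, rfl⟩, ?_⟩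
    simp only [LinearMap.add_apply, LinearMap.sub_apply, map_smul]
    module
  · rw [eq_bot_iff]
    rintro x ⟨hxP, hxN⟩
    by_contra hne
    exact lt_asymm (hP x hxP hne) (hN x hxN hne)
  · refine LinearMap.finrank_range_of_inj ((injective_iff_map_eq_zero _).2 fun w hw => ?_)
    by_contra hne
    have h := hadd w
    rw [hw, map_zero] at h
    exact (hpos w hne).ne' (by simpa using h.symm)
  · refine LinearMap.finrank_range_of_inj ((injective_iff_map_eq_zero _).2 fun w hw => ?_)
    by_contra hne
    have h := hsub w
    rw [hw, map_zero] at h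
    exact (hpos w hne).ne' (by simpa using h.symm)

end DualIsotropicPair

/-- the induced pairing `P_K` on `J₁(K) ⊕ J₂(K)`, Section 6:
under the assumptions (1)–(3), `dim J₁K = dim J₂K = m = dim K`, `J₁K ∩ J₂K = 0`,
both `J₁K` and `J₂K` are isotropic, `⟨J₁k, J₂k'⟩ = ⟨Gk, k'⟩` for `k, k' ∈ K`,
the restriction of `⟨,⟩` to `J₁K ⊕ J₂K` is nondegenerate and has signature `(m,m)`. -/
theorem statement15 {V : Type*} [AddCommGroup V] [Module ℝ V] [FiniteDimensional ℝ V]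
    (J₁ J₂ : GV V →ₗ[ℝ] GV V) (h : IsGenKahler J₁ J₂)
    (K : Submodule ℝ (Module.Dual ℝ V))
    (h1 : ofDual K ⊔ (ofDual K).map J₁ ≤ Ann (ofDual K ⊔ (ofDual K).map J₁))
    (h1' : ofDual K ⊔ (ofDual K).map J₂ ≤ Ann (ofDual K ⊔ (ofDual K).map J₂))
    (h2 : (ofDual K).map J₁ ⊓ VStar V = ⊥)
    (h2' : (ofDual K).map J₂ ⊓ VStar V = ⊥)
    (h3 : ((ofDual K).map J₁).map (LinearMap.fst ℝ V (Module.Dual ℝ V)) ⊓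
          ((ofDual K).map J₂).map (LinearMap.fst ℝ V (Module.Dual ℝ V)) = ⊥) :
    let Kv : Submodule ℝ (GV V) := ofDual K
    let m : ℕ := Module.finrank ℝ K
    let S : Submodule ℝ (GV V) := Kv.map J₁ ⊔ Kv.map J₂
    Module.finrank ℝ (Kv.map J₁) = m ∧ Module.finrank ℝ (Kv.map J₂) = m ∧
    Kv.map J₁ ⊓ Kv.map J₂ = ⊥ ∧
    (∀ x ∈ Kv.map J₁, ∀ y ∈ Kv.map J₁, pairForm V x y = 0) ∧
    (∀ x ∈ Kv.map J₂, ∀ y ∈ Kv.map J₂, pairForm V x y = 0) ∧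
    (∀ k ∈ K, ∀ k' ∈ K,
      pairForm V (J₁ ((0 : V), k)) (J₂ ((0 : V), k'))
        = pairForm V (-(J₁ (J₂ ((0 : V), k)))) ((0 : V), k')) ∧
    (∀ x ∈ S, (∀ y ∈ S, pairForm V x y = 0) → x = 0) ∧
    ∃ P Neg : Submodule ℝ (GV V), P ≤ S ∧ Neg ≤ S ∧ P ⊔ Neg = S ∧ P ⊓ Neg = ⊥ ∧
      Module.finrank ℝ P = m ∧ Module.finrank ℝ Neg = m ∧
      (∀ x ∈ P, x ≠ 0 → 0 < pairForm V x x) ∧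
      (∀ x ∈ Neg, x ≠ 0 → pairForm V x x < 0) := by
  intro Kv m S
  obtain ⟨ι, hι⟩ : ∃ ι : K →ₗ[ℝ] GV V, ι = LinearMap.inr ℝ V (Module.Dual ℝ V) ∘ₗ K.subtype :=
    ⟨_, rfl⟩
  have hι₀ : ∀ k, ι k = ((0 : V), (k : Module.Dual ℝ V)) := fun k => by simp [hι]
  obtain ⟨f, hfJ⟩ : ∃ f : K →ₗ[ℝ] GV V, f = J₁ ∘ₗ ι := ⟨_, rfl⟩
  obtain ⟨g, hgJ⟩ : ∃ g : K →ₗ[ℝ] GV V, g = J₂ ∘ₗ ι := ⟨_, rfl⟩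
  have e₁ : Kv.map J₁ = LinearMap.range f := by
    rw [hfJ, hι]
    exact map_ofDual_eq_range J₁ K
  have e₂ : Kv.map J₂ = LinearMap.range g := by
    rw [hgJ, hι]
    exact map_ofDual_eq_range J₂ K
  have hf : ∀ k k', pairForm V (f k) (f k') = 0 := fun k k' => by
    rw [hfJ, LinearMap.comp_apply, LinearMap.comp_apply, h.cx1.orth, hι₀, hι₀, pairForm_dual]
  have hg : ∀ k k', pairForm V (g k) (g k') = 0 := fun k k' => by
    rw [hgJ, LinearMap.comp_apply, LinearMap.comp_apply, h.cx2.orth, hι₀, hι₀, pairForm_dual]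
  have hpos : ∀ k, k ≠ 0 → 0 < pairForm V (f k) (g k) := fun k hk => by
    rw [hfJ, hgJ, LinearMap.comp_apply, LinearMap.comp_apply, h.pairForm_map_map]
    refine h.posdef _ fun h0 => hk (Subtype.ext ?_)
    rw [hι₀] at h0
    exact congrArg Prod.snd h0
  have hS : S = LinearMap.range f ⊔ LinearMap.range g := by
    rw [← e₁, ← e₂]
  rw [hS, e₁, e₂]
  refine ⟨?_, ?_, ?_, ?_, ?_, ?_, ?_, ?_⟩
  · exact LinearMap.finrank_range_of_inj (injective_left_of_pos hpos)
  · exact LinearMap.finrank_range_of_inj (injective_right_of_pos hpos)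
  · exact range_inf_range_eq_bot_of_pos hg hpos
  · rintro _ ⟨k, rfl⟩ _ ⟨k', rfl⟩
    exact hf k k'
  · rintro _ ⟨k, rfl⟩ _ ⟨k', rfl⟩
    exact hg k k'
  · exact fun k _ k' _ => h.pairForm_map_map _ _
  · exact eq_zero_of_forall_mem_range_sup hf hg hpos
  · exact exists_pos_neg_splitting hf hg hpos
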